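/- Every Boolean valuation — a map v from formulas to {T, F} induced by an assignment of the atoms and computed by the deterministic classical truth tables (v(⊥) = F, v(⊤) = T, v(¬α) = T iff v(α) = F, v(α → β) = F iff v(α) = T and v(β) = F, classical ∧ and ∨) — is a valuation of M_{IL_p} and belongs to L^{IL_p}. Consequently, every tautology of the RNmatrix R(M_{IL_p}) = ⟨L^{IL_p}, M_{IL_p}⟩ is a classical tautology. -/

import Mathlib

/-- Formulas of intuitionistic propositional logic. -/
inductive IForm : Type where
  | atom : ℕ → IForm
  | bot : IForm
  | top : IForm
  | neg : IForm → IForm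
  | imp : IForm → IForm → IForm
  | conj : IForm → IForm → IForm
  | disj : IForm → IForm → IForm
deriving DecidableEq

/-- Multifunction for negation in `M_{ILp}`: `¬̃F = {F, T}`, `¬̃T = {F}`.
(`true` is the value `T`, `false` is `F`.) -/
def INeg : Bool → Set Bool
  | false => Set.univ
  | true => {false}

/-- Multifunction for implication in `M_{ILp}`. -/
def IImp : Bool → Bool → Set Bool
  | false, false => Set.univ
  | false, true => {true}
  | true, false => {false}
  | true, true => {true}

/-- `v ∈ Val(M_{ILp})`. -/
def IIsVal (v : IForm → Bool) : Prop :=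
  v IForm.bot = false ∧ v IForm.top = true ∧
  (∀ a, v (IForm.neg a) ∈ INeg (v a)) ∧
  (∀ a b, v (IForm.imp a b) ∈ IImp (v a) (v b)) ∧
  (∀ a b, v (IForm.conj a b) = (v a && v b)) ∧
  (∀ a b, v (IForm.disj a b) = (v a || v b))

/-- The levels `L_k` of valuations of `M_{ILp}`. -/
def ILev : ℕ → Set (IForm → Bool)
  | 0 => {v | IIsVal v}
  | k + 1 => {v | v ∈ ILev k ∧
      (∀ a b, v a = false → v b = false → v (IForm.imp a b) = false →
        ∃ w ∈ ILev k, w a = true ∧ w b = false ∧ ∀ c, v c = true → w c = true) ∧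
      (∀ a, v a = false → v (IForm.neg a) = false →
        ∃ w ∈ ILev k, w a = true ∧ ∀ c, v c = true → w c = true)}

/-- `L^{ILp} = ⋂_k L_k`, the restricted set of valuations of the RNmatrix for `ILp`. -/
def ILimit : Set (IForm → Bool) := {v | ∀ k, v ∈ ILev k}

/-- The Boolean valuation induced by an assignment of the atoms,
computed by the deterministic classical truth tables. -/
def beval (σ : ℕ → Bool) : IForm → Bool
  | IForm.atom n => σ n
  | IForm.bot => false
  | IForm.top => true
  | IForm.neg a => !(beval σ a)
  | IForm.imp a b => !(beval σ a) || beval σ b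
  | IForm.conj a b => beval σ a && beval σ b
  | IForm.disj a b => beval σ a || beval σ b

theorem isVal_beval (σ : ℕ → Bool) : IIsVal (beval σ) := by
  refine ⟨rfl, rfl, fun a => ?_, fun a b => ?_, fun _ _ => rfl, fun _ _ => rfl⟩
  · cases h : beval σ a <;> simp [beval, INeg, h]
  · cases h : beval σ a <;> cases h' : beval σ b <;> simp [beval, IImp, h, h']

theorem beval_mem_ILev (σ : ℕ → Bool) (k : ℕ) : beval σ ∈ ILev k := by
  induction k with
  | zero => exact isVal_beval σ
  | succ k ih =>
    refine ⟨ih, fun a b ha _ hab => ?_, fun a ha hna => ?_⟩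
    · simp [beval, ha] at hab
    · simp [beval, ha] at hna

theorem boolean_valuations_in_limit_and_RNmatrix_tautologies_are_classical :
    (∀ σ : ℕ → Bool, IIsVal (beval σ) ∧ beval σ ∈ ILimit) ∧
    (∀ φ : IForm, (∀ v ∈ ILimit, v φ = true) → ∀ σ : ℕ → Bool, beval σ φ = true) := by
  exact ⟨fun σ => ⟨isVal_beval σ, beval_mem_ILev σ⟩,
    fun _ h σ => h (beval σ) (beval_mem_ILev σ)⟩
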